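/- Let l ≥ 2 be an integer, and define E = A_{l−1} ∪ (2^{l−1} + 1 + B_{l−1}) ∪ (2^l + 1 + B_{l−1}) and F = B_{l−1} ∪ (2^{l−1} + 1 + A_{l−1}) ∪ (2^l + 1 + A_{l−1}). Then R_E(n) = R_F(n) for every nonnegative integer n ≤ 3·2^{l−1}. -/

import Mathlib

/-- `R S n` is the number of pairs `(s₁, s₂)` with `s₁, s₂ ∈ S`, `s₁ < s₂` and `s₁ + s₂ = n`. -/
noncomputable def R (S : Set ℕ) (n : ℕ) : ℕ :=
  Set.ncard {p : ℕ × ℕ | p.1 ∈ S ∧ p.2 ∈ S ∧ p.1 < p.2 ∧ p.1 + p.2 = n}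

/-- `A` is the set of nonnegative integers with an even number of binary digits `1`. -/
def A : Set ℕ := {n | Even ((Nat.digits 2 n).count 1)}

/-- `B = ℕ \ A`. -/
def B : Set ℕ := Set.univ \ A

/-- `A_l = A ∩ [0, 2^l - 1]`. -/
def Aset (l : ℕ) : Set ℕ := A ∩ Set.Icc 0 (2 ^ l - 1)

/-- `B_l = B ∩ [0, 2^l - 1]`. -/
def Bset (l : ℕ) : Set ℕ := B ∩ Set.Icc 0 (2 ^ l - 1)

/-- `t + S = {t + s : s ∈ S}`. -/
def shift (t : ℕ) (S : Set ℕ) : Set ℕ := (fun s => t + s) '' S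

open Polynomial

lemma two_mul_mem_A (n : ℕ) : 2 * n ∈ A ↔ n ∈ A := by
  rcases Nat.eq_zero_or_pos n with rfl | h
  · simp
  · have h' : Nat.digits 2 (2 * n) = 0 :: Nat.digits 2 n := by
      simpa using Nat.digits_add 2 (by norm_num) 0 n (by norm_num) (Or.inr h.ne')
    simp only [A, Set.mem_ofPred_eq, h']
    simp

lemma two_mul_add_one_mem_A (n : ℕ) : 2 * n + 1 ∈ A ↔ n ∉ A := by
  have h : Nat.digits 2 (2 * n + 1) = 1 :: Nat.digits 2 n := by
    rw [add_comm]
    exact Nat.digits_add 2 (by norm_num) 1 n (by norm_num) (Or.inl one_ne_zero)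
  simp only [A, Set.mem_ofPred_eq, h]
  simp [Nat.even_add_one]

open Classical in
/-- The polynomial `∑ ± X ^ n` over `n < 2 ^ k`, where the sign is `+` exactly for `n ∈ A`. -/
noncomputable def signPoly (k : ℕ) : ℤ[X] :=
  ∑ n ∈ Finset.range (2 ^ k), (if n ∈ A then 1 else -1) * X ^ n

lemma signPoly_succ (k : ℕ) : signPoly (k + 1) = (1 - X) * expand ℤ 2 (signPoly k) := by
  have key : ∀ (f : ℕ → ℤ[X]) (m : ℕ),
      ∑ n ∈ Finset.range (2 * m), f n = ∑ n ∈ Finset.range m, (f (2 * n) + f (2 * n + 1)) := by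
    intro f m
    induction m with
    | zero => simp
    | succ m ih => rw [mul_add, mul_one, Finset.sum_range_succ, Finset.sum_range_succ, ih,
        Finset.sum_range_succ, add_assoc]
  rw [signPoly, signPoly, pow_succ', key, map_sum, Finset.mul_sum]
  refine Finset.sum_congr rfl fun n _ => ?_
  rw [map_mul, map_pow, expand_X]
  by_cases h : n ∈ A <;> simp [two_mul_mem_A, two_mul_add_one_mem_A, h] <;> ring

lemma signPoly_eq_prod (k : ℕ) :
    signPoly k = ∏ i ∈ Finset.range k, (1 - X ^ 2 ^ i) := by
  induction k with
  | zero => simp [signPoly, A]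
  | succ k ih =>
    rw [signPoly_succ, ih, Finset.prod_range_succ', map_prod, mul_comm]
    simp only [map_sub, map_one, map_pow, expand_X, ← pow_mul, ← pow_succ', pow_zero, pow_one]

lemma one_sub_X_mul_expand_signPoly (k : ℕ) :
    (1 - X) * expand ℤ 2 (signPoly k) = signPoly k * (1 - X ^ 2 ^ k) := by
  rw [← signPoly_succ, signPoly_eq_prod, Finset.prod_range_succ, ← signPoly_eq_prod]

/-- The generating polynomial of a finite set. -/
noncomputable def genPoly (S : Finset ℕ) : ℤ[X] := ∑ s ∈ S, X ^ s

lemma genPoly_union {S T : Finset ℕ} (h : Disjoint S T) :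
    genPoly (S ∪ T) = genPoly S + genPoly T :=
  Finset.sum_union h

lemma genPoly_image_add (t : ℕ) (S : Finset ℕ) :
    genPoly (S.image (t + ·)) = X ^ t * genPoly S := by
  rw [genPoly, Finset.sum_image (by simp), genPoly, Finset.mul_sum]
  simp [pow_add]

lemma R_eq_card (S : Finset ℕ) (n : ℕ) :
    R S n = (((S ×ˢ S).filter fun p => p.1 < p.2).filter fun p => p.1 + p.2 = n).card := by
  rw [R, ← Set.ncard_coe_finset]
  congr 1
  ext p
  simp [and_assoc]

lemma coeff_genPoly_sq (S : Finset ℕ) (n : ℕ) :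
    (genPoly S ^ 2).coeff n = 2 * R S n + (expand ℤ 2 (genPoly S)).coeff n := by
  have coeff_sum : ∀ Q : Finset (ℕ × ℕ), (∑ p ∈ Q, (X : ℤ[X]) ^ (p.1 + p.2)).coeff n =
      ((Q.filter fun p => p.1 + p.2 = n).card : ℤ) := by
    intro Q
    simp [coeff_X_pow, eq_comm]
  have hsq : genPoly S ^ 2 = ∑ p ∈ S ×ˢ S, X ^ (p.1 + p.2) := by
    rw [sq, genPoly, Finset.sum_mul_sum, Finset.sum_product]
    simp [pow_add]
  have hdiag : expand ℤ 2 (genPoly S) =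
      ∑ p ∈ (S ×ˢ S).filter (fun p => p.1 = p.2), X ^ (p.1 + p.2) := by
    rw [genPoly, map_sum]
    refine Finset.sum_bij' (fun s _ => (s, s)) (fun p _ => p.1) ?_ ?_ ?_ ?_ ?_
    · simp
    · simp +contextual
    · simp
    · simp +contextual
    · intro s _
      simp [← pow_mul, two_mul]
  have hswap : ∑ p ∈ (S ×ˢ S).filter (fun p => p.2 < p.1), (X : ℤ[X]) ^ (p.1 + p.2) =
      ∑ p ∈ (S ×ˢ S).filter (fun p => p.1 < p.2), X ^ (p.1 + p.2) := by
    refine Finset.sum_bij' (fun p _ => p.swap) (fun p _ => p.swap) ?_ ?_ ?_ ?_ ?_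
    · simp +contextual
    · simp +contextual
    · simp
    · simp
    · intro p _
      simp [add_comm]
  have hsplit : ∑ p ∈ S ×ˢ S, (X : ℤ[X]) ^ (p.1 + p.2) =
      ∑ p ∈ (S ×ˢ S).filter (fun p => p.1 < p.2), X ^ (p.1 + p.2) +
      ∑ p ∈ (S ×ˢ S).filter (fun p => p.2 < p.1), X ^ (p.1 + p.2) +
      ∑ p ∈ (S ×ˢ S).filter (fun p => p.1 = p.2), X ^ (p.1 + p.2) := by
    simp only [Finset.sum_filter, ← Finset.sum_add_distrib]
    refine Finset.sum_congr rfl fun p _ => ?_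
    rcases lt_trichotomy p.1 p.2 with h | h | h
    · simp [h, h.not_gt, h.ne]
    · simp [h]
    · simp [h, h.not_gt, h.ne']
  rw [hsq, hsplit, hswap, ← hdiag, coeff_add, coeff_add, coeff_sum, R_eq_card]
  ring

/-- If `a - b = signPoly k` and `a + b = ∑ n < 2 ^ k, X ^ n`, then the sets with generating
polynomials `a + c b` and `b + c a`, `c = X ^ (2 ^ k + 1) + X ^ (2 * 2 ^ k + 1)`, have generating
functions of twice the representation counts differing by a multiple of `X ^ (3 * 2 ^ k + 2)`. -/
lemma genFun_sub_genFun (k : ℕ) (a b c : ℤ[X]) (hsub : a - b = signPoly k)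
    (hadd : a + b = ∑ n ∈ Finset.range (2 ^ k), X ^ n)
    (hc : c = X ^ (2 ^ k + 1) + X ^ (2 * 2 ^ k + 1)) :
    ((a + c * b) ^ 2 - expand ℤ 2 (a + c * b)) - ((b + c * a) ^ 2 - expand ℤ 2 (b + c * a)) =
      X ^ (3 * 2 ^ k + 2) * (-2 * expand ℤ 2 (signPoly k)) := by
  have hT : (a - b) * (a + b) = expand ℤ 2 (signPoly k) := by
    have h1 : (1 - X : ℤ[X]) ≠ 0 := by
      rw [sub_ne_zero]
      exact (X_ne_C 1).symm
    apply mul_left_cancel₀ h1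
    rw [one_sub_X_mul_expand_signPoly, hsub, hadd, ← mul_neg_geom_sum (X : ℤ[X]) (2 ^ k)]
    ring
  have hE : expand ℤ 2 a - expand ℤ 2 b = expand ℤ 2 (signPoly k) := by
    rw [← map_sub, hsub]
  have hc2 : expand ℤ 2 c = c ^ 2 - 2 * X ^ (3 * 2 ^ k + 2) := by
    rw [hc]
    simp only [map_add, map_pow, expand_X]
    ring
  simp only [map_add, map_mul, hc2]
  linear_combination (1 - c ^ 2) * hT - (1 - c ^ 2 + 2 * X ^ (3 * 2 ^ k + 2)) * hE

theorem stmt_12 (l : ℕ) (hl : 2 ≤ l) (E F : Set ℕ)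
    (hE : E = Aset (l - 1) ∪ shift (2 ^ (l - 1) + 1) (Bset (l - 1)) ∪
      shift (2 ^ l + 1) (Bset (l - 1)))
    (hF : F = Bset (l - 1) ∪ shift (2 ^ (l - 1) + 1) (Aset (l - 1)) ∪
      shift (2 ^ l + 1) (Aset (l - 1))) :
    ∀ n ≤ 3 * 2 ^ (l - 1), R E n = R F n := by
  classical
  intro n hn
  obtain ⟨k, rfl⟩ : ∃ k, l = k + 1 := ⟨l - 1, by omega⟩
  rw [Nat.add_sub_cancel] at hE hF hn
  rw [pow_succ'] at hE hF
  have hpos : 0 < 2 ^ k := by positivity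
  set a := (Finset.range (2 ^ k)).filter (· ∈ A) with ha
  set b := (Finset.range (2 ^ k)).filter (· ∉ A) with hb
  have haA : Aset k = a := by
    ext x
    simp [Aset, ha, Nat.le_sub_one_iff_lt hpos, and_comm]
  have hbB : Bset k = b := by
    ext x
    simp [Bset, B, hb, Nat.le_sub_one_iff_lt hpos, and_comm]
  have ha_lt : ∀ x ∈ a, x < 2 ^ k := fun x hx => by simpa using (Finset.mem_filter.1 hx).1
  have hb_lt : ∀ x ∈ b, x < 2 ^ k := fun x hx => by simpa using (Finset.mem_filter.1 hx).1
  have hgen : ∀ u v : Finset ℕ, (∀ x ∈ u, x < 2 ^ k) → (∀ x ∈ v, x < 2 ^ k) →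
      genPoly (u ∪ v.image (2 ^ k + 1 + ·) ∪ v.image (2 * 2 ^ k + 1 + ·)) =
        genPoly u + (X ^ (2 ^ k + 1) + X ^ (2 * 2 ^ k + 1)) * genPoly v := by
    intro u v hu hv
    rw [genPoly_union, genPoly_union, genPoly_image_add, genPoly_image_add]
    · ring
    · rw [Finset.disjoint_left]
      intro x hx hx'
      obtain ⟨y, hy, rfl⟩ := Finset.mem_image.1 hx'
      have := hu _ hx
      omega
    · rw [Finset.disjoint_left]
      intro x hx hx'
      obtain ⟨y, hy, rfl⟩ := Finset.mem_image.1 hx'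
      rcases Finset.mem_union.1 hx with hx | hx
      · have := hu _ hx
        omega
      · obtain ⟨z, hz, hzy⟩ := Finset.mem_image.1 hx
        have := hv _ hz
        omega
  have hE' : E = (a ∪ b.image (2 ^ k + 1 + ·) ∪ b.image (2 * 2 ^ k + 1 + ·) : Finset ℕ) := by
    rw [hE, haA, hbB]
    simp [shift, Set.union_assoc]
  have hF' : F = (b ∪ a.image (2 ^ k + 1 + ·) ∪ a.image (2 * 2 ^ k + 1 + ·) : Finset ℕ) := by
    rw [hF, haA, hbB]
    simp [shift, Set.union_assoc]
  have hsub : genPoly a - genPoly b = signPoly k := by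
    simp only [genPoly, signPoly, ha, hb, Finset.sum_filter, ← Finset.sum_sub_distrib]
    refine Finset.sum_congr rfl fun x _ => ?_
    by_cases h : x ∈ A <;> simp [h]
  have hadd : genPoly a + genPoly b = ∑ n ∈ Finset.range (2 ^ k), X ^ n :=
    Finset.sum_filter_add_sum_filter_not _ _ _
  have key := congrArg (coeff · n) (genFun_sub_genFun k _ _ _ hsub hadd rfl)
  simp only [← hgen a b ha_lt hb_lt, ← hgen b a hb_lt ha_lt, coeff_sub, coeff_genPoly_sq,
    coeff_X_pow_mul', if_neg (show ¬ 3 * 2 ^ k + 2 ≤ n by omega), ← hE', ← hF'] at key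
  omega
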